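/- Let f : ℝⁿ → ℝ be C³ with L-Lipschitz third derivative, let x satisfy ∇f(x) = 0 and ∇²f(x) ⪰ 0 with smallest nonzero eigenvalue α > 0, and suppose ∇³f(x)(u,u,u) = 0 for all u ∈ ker ∇²f(x). Write y - x = u + v with u ∈ ker ∇²f(x) and v ∈ (ker ∇²f(x))^⊥, and let β bound the relevant injective norms of ∇³f(x). Then for all y with ‖y-x‖ ≤ β/α, f(y) - f(x) ≥ -(β²/α + L/24)‖y-x‖⁴. -/

import Mathlib

noncomputable def frob3 {n : ℕ}
    (T : ContinuousMultilinearMap ℝ (fun _ : Fin 3 => EuclideanSpace ℝ (Fin n)) ℝ) : ℝ :=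
  Real.sqrt (∑ i : Fin n, ∑ j : Fin n, ∑ k : Fin n,
    (T ![EuclideanSpace.single i 1, EuclideanSpace.single j 1, EuclideanSpace.single k 1]) ^ 2)

theorem aux_frob {n : ℕ}
    (T : ContinuousMultilinearMap ℝ (fun _ : Fin 3 => EuclideanSpace ℝ (Fin n)) ℝ)
    (h : EuclideanSpace ℝ (Fin n)) : |T ![h, h, h]| ≤ frob3 T * ‖h‖ ^ 3 := by
  let e : Fin n → EuclideanSpace ℝ (Fin n) := fun i => EuclideanSpace.single i 1
  have hh : h = ∑ i, h i • e i := by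
    ext j
    simp [e, Finset.sum_apply, Pi.single_apply]
  have h1 : T ![h, h, h] = ∑ r : Fin 3 → Fin n, (∏ i, h (r i)) * T (fun i => e (r i)) := by
    have : (![h, h, h] : Fin 3 → EuclideanSpace ℝ (Fin n)) = fun _ => ∑ i, h i • e i := by
      rw [← hh]; ext i; fin_cases i <;> rfl
    rw [this, T.map_sum]
    refine Finset.sum_congr rfl fun r _ => ?_
    rw [T.map_smul_univ, smul_eq_mul]
  let E : (Fin 3 → Fin n) ≃ Fin n × Fin n × Fin n :=
    { toFun := fun r => (r 0, r 1, r 2)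
      invFun := fun p => ![p.1, p.2.1, p.2.2]
      left_inv := fun r => by ext i; fin_cases i <;> rfl
      right_inv := fun p => rfl }
  have h2 : frob3 T = Real.sqrt (∑ r : Fin 3 → Fin n, (T (fun i => e (r i))) ^ 2) := by
    unfold frob3
    congr 1
    rw [← E.symm.sum_comp, Fintype.sum_prod_type]
    refine Finset.sum_congr rfl fun i _ => ?_
    rw [Fintype.sum_prod_type]
    refine Finset.sum_congr rfl fun j _ => ?_
    refine Finset.sum_congr rfl fun k _ => ?_
    congr 2
    ext l; fin_cases l <;> rfl
  have h3 : ∑ r : Fin 3 → Fin n, (∏ i, h (r i)) ^ 2 = (‖h‖ ^ 3) ^ 2 := by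
    have : ∀ r : Fin 3 → Fin n, (∏ i, h (r i)) ^ 2 = ∏ i, (h (r i)) ^ 2 := fun r => by
      rw [Finset.prod_pow]
    simp_rw [this]
    rw [← Fintype.piFinset_univ, ← Finset.prod_univ_sum (fun _ => Finset.univ) (fun _ j => (h j) ^ 2)]
    simp [← EuclideanSpace.real_norm_sq_eq]
    ring
  have h4 := Finset.sum_mul_sq_le_sq_mul_sq Finset.univ
    (fun r : Fin 3 → Fin n => ∏ i, h (r i)) (fun r => T (fun i => e (r i)))
  rw [← h1, h3] at h4
  apply abs_le_of_sq_le_sq _ (by unfold frob3; positivity)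
  rw [h2, mul_pow, Real.sq_sqrt (by positivity)]
  linarith

theorem aux_deriv {n : ℕ} {f : EuclideanSpace ℝ (Fin n) → ℝ} (hf : ContDiff ℝ 3 f)
    (k : ℕ) (hk : k < 3) (x h : EuclideanSpace ℝ (Fin n)) (m : Fin k → EuclideanSpace ℝ (Fin n))
    (t : ℝ) :
    HasDerivAt (fun t : ℝ => iteratedFDeriv ℝ k f (x + t • h) m)
      (iteratedFDeriv ℝ (k + 1) f (x + t • h) (Fin.cons h m)) t := by
  have hd : Differentiable ℝ (iteratedFDeriv ℝ k f) :=
    hf.differentiable_iteratedFDeriv (by exact_mod_cast hk)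
  have h1 : HasDerivAt (fun t : ℝ => x + t • h) h t := by
    simpa using ((hasDerivAt_id t).smul_const h).const_add x
  have h2 := (hd (x + t • h)).hasFDerivAt.comp_hasDerivAt t h1
  have h3 := (ContinuousMultilinearMap.apply ℝ (fun _ : Fin k => EuclideanSpace ℝ (Fin n)) ℝ m).hasFDerivAt.comp_hasDerivAt t h2
  rw [iteratedFDeriv_succ_apply_left]
  simpa [Function.comp_def] using h3

theorem aux_sym2 {n : ℕ} {f : EuclideanSpace ℝ (Fin n) → ℝ} (hf : ContDiff ℝ 3 f)
    (x a b : EuclideanSpace ℝ (Fin n)) :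
    iteratedFDeriv ℝ 2 f x ![a, b] = iteratedFDeriv ℝ 2 f x ![b, a] := by
  have : IsSymmSndFDerivAt ℝ f x := hf.contDiffAt.isSymmSndFDerivAt (by simp; norm_num)
  exact IsSymmSndFDerivAt.iteratedFDeriv_cons (hf := this)

theorem aux_sym3a {n : ℕ} {f : EuclideanSpace ℝ (Fin n) → ℝ} (hf : ContDiff ℝ 3 f)
    (x a b c : EuclideanSpace ℝ (Fin n)) :
    iteratedFDeriv ℝ 3 f x ![a, b, c] = iteratedFDeriv ℝ 3 f x ![a, c, b] := by
  have h1 := aux_deriv hf 2 (by norm_num) x a ![b, c] 0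
  have h2 := aux_deriv hf 2 (by norm_num) x a ![c, b] 0
  simp_rw [aux_sym2 hf _ b c] at h1
  have := h1.unique h2
  simpa using this

theorem aux_sym3b {n : ℕ} {f : EuclideanSpace ℝ (Fin n) → ℝ} (hf : ContDiff ℝ 3 f)
    (x a b c : EuclideanSpace ℝ (Fin n)) :
    iteratedFDeriv ℝ 3 f x ![a, b, c] = iteratedFDeriv ℝ 3 f x ![b, a, c] := by
  have hg : ContDiff ℝ 2 (fderiv ℝ f) := hf.fderiv_right (by norm_num)
  have : IsSymmSndFDerivAt ℝ (fderiv ℝ f) x := hg.contDiffAt.isSymmSndFDerivAt (by simp)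
  have h2 := IsSymmSndFDerivAt.iteratedFDeriv_cons (hf := this) (v := a) (w := b)
  rw [iteratedFDeriv_succ_apply_right (n := 2) ![a, b, c],
    iteratedFDeriv_succ_apply_right (n := 2) ![b, a, c]]
  have e1 : Fin.init ![a, b, c] = ![a, b] := by ext i; fin_cases i <;> rfl
  have e2 : Fin.init ![b, a, c] = ![b, a] := by ext i; fin_cases i <;> rfl
  rw [e1, e2]
  exact congrArg (fun l => l c) h2

theorem aux_mono (g g' : ℝ → ℝ) (hg : ∀ t, HasDerivAt g (g' t) t) (h0 : g 0 = 0)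
    (hp : ∀ t, 0 ≤ t → 0 ≤ g' t) : ∀ t, 0 ≤ t → 0 ≤ g t := by
  intro t ht
  have : MonotoneOn g (Set.Ici 0) := by
    refine monotoneOn_of_hasDerivWithinAt_nonneg (convex_Ici 0)
      (fun y hy ↦ (hg y).continuousAt.continuousWithinAt)
      (fun y hy ↦ (hg y).hasDerivWithinAt) ?_
    intro y hy
    exact hp y (interior_subset hy)
  rw [← h0]
  exact this (by simp) ht ht

theorem aux_taylor (p0 p1 p2 p3 : ℝ → ℝ) (M : ℝ) (h0 : ∀ t, HasDerivAt p0 (p1 t) t)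
    (h1 : ∀ t, HasDerivAt p1 (p2 t) t) (h2 : ∀ t, HasDerivAt p2 (p3 t) t)
    (h3 : ∀ t, 0 ≤ t → p3 0 - M * t ≤ p3 t) :
    p0 0 + p1 0 + p2 0 / 2 + p3 0 / 6 - M / 24 ≤ p0 1 := by
  have i2 := aux_mono (fun t => p2 t - (p2 0 + p3 0 * t - M / 2 * t ^ 2))
    (fun t => p3 t - (p3 0 - M * t)) (fun t => by
      refine (h2 t).sub ?_
      have := (((hasDerivAt_id t).const_mul (p3 0)).const_add (p2 0)).sub
        ((hasDerivAt_pow 2 t).const_mul (M / 2))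
      refine this.congr_deriv ?_
      norm_num; ring) (by simp) (fun t ht => by linarith [h3 t ht])
  have i1 := aux_mono (fun t => p1 t - (p1 0 + p2 0 * t + p3 0 / 2 * t ^ 2 - M / 6 * t ^ 3))
    _ (fun t => by
      refine (h1 t).sub ?_
      have := ((((hasDerivAt_id t).const_mul (p2 0)).const_add (p1 0)).add
        ((hasDerivAt_pow 2 t).const_mul (p3 0 / 2))).sub ((hasDerivAt_pow 3 t).const_mul (M / 6))
      refine this.congr_deriv ?_
      show _ = (p2 0 + p3 0 * t - M / 2 * t ^ 2)
      norm_num; ring) (by simp) i2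
  have i0 := aux_mono (fun t => p0 t - (p0 0 + p1 0 * t + p2 0 / 2 * t ^ 2 + p3 0 / 6 * t ^ 3
      - M / 24 * t ^ 4))
    _ (fun t => by
      refine (h0 t).sub ?_
      have := (((((hasDerivAt_id t).const_mul (p1 0)).const_add (p0 0)).add
        ((hasDerivAt_pow 2 t).const_mul (p2 0 / 2))).add
        ((hasDerivAt_pow 3 t).const_mul (p3 0 / 6))).sub ((hasDerivAt_pow 4 t).const_mul (M / 24))
      refine this.congr_deriv ?_
      show _ = (p1 0 + p2 0 * t + p3 0 / 2 * t ^ 2 - M / 6 * t ^ 3)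
      norm_num; ring) (by simp) i1
  have := i0 1 (by norm_num)
  norm_num at this
  linarith

theorem aux_real (α β a b r : ℝ) (hα : 0 < α) (hβ : 0 ≤ β) (ha : 0 ≤ a) (hb : 0 ≤ b)
    (hr : r ^ 2 = a ^ 2 + b ^ 2) :
    -(β ^ 2 / α) * r ^ 4 ≤ α * b ^ 2 / 2
      - (3 * (β * a * a * b) + 3 * (β * a * b * b) + β * b * b * b) / 6 := by
  have h1 : 0 ≤ (α * b - β * r ^ 2) ^ 2 / (2 * α) := by positivity
  have h2 : (α * b - β * r ^ 2) ^ 2 / (2 * α)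
      = α * b ^ 2 / 2 - β * b * r ^ 2 + (β ^ 2 / α) * r ^ 4 / 2 := by
    field_simp; ring
  have h3 : 0 ≤ (β ^ 2 / α) * r ^ 4 := by positivity
  have h4 : (3 * (β * a * a * b) + 3 * (β * a * b * b) + β * b * b * b) / 6 ≤ β * b * r ^ 2 := by
    have : 0 ≤ β * b * (r ^ 2 - (3 * a ^ 2 + 3 * a * b + b ^ 2) / 6) := by
      apply mul_nonneg (by positivity)
      rw [hr]
      nlinarith [sq_nonneg (a - b)]
    nlinarith
  linarith

theorem third_order_min_quantitative {n : ℕ} (f : EuclideanSpace ℝ (Fin n) → ℝ)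
    (L α β : ℝ) (hα : 0 < α) (hβ : 0 ≤ β)
    (hf : ContDiff ℝ 3 f)
    (hLip : ∀ x y, frob3 (iteratedFDeriv ℝ 3 f x - iteratedFDeriv ℝ 3 f y) ≤ L * ‖x - y‖)
    (x : EuclideanSpace ℝ (Fin n))
    (U : Submodule ℝ (EuclideanSpace ℝ (Fin n)))
    (hgrad : gradient f x = 0)
    (hpsd : ∀ v, 0 ≤ iteratedFDeriv ℝ 2 f x ![v, v])
    (hkernel : ∀ u ∈ U, ∀ w, iteratedFDeriv ℝ 2 f x ![u, w] = 0)
    (hαeig : ∀ v ∈ Uᗮ, α * ‖v‖ ^ 2 ≤ iteratedFDeriv ℝ 2 f x ![v, v])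
    (hU0 : ∀ u ∈ U, iteratedFDeriv ℝ 3 f x ![u, u, u] = 0)
    (hβ1 : ∀ u ∈ U, ∀ v ∈ Uᗮ, ∀ w ∈ Uᗮ,
      |iteratedFDeriv ℝ 3 f x ![u, v, w]| ≤ β * ‖u‖ * ‖v‖ * ‖w‖)
    (hβ2 : ∀ u ∈ U, ∀ u' ∈ U, ∀ v ∈ Uᗮ,
      |iteratedFDeriv ℝ 3 f x ![u, u', v]| ≤ β * ‖u‖ * ‖u'‖ * ‖v‖)
    (hβ3 : ∀ v ∈ Uᗮ, ∀ v' ∈ Uᗮ, ∀ v'' ∈ Uᗮ,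
      |iteratedFDeriv ℝ 3 f x ![v, v', v'']| ≤ β * ‖v‖ * ‖v'‖ * ‖v''‖) :
    ∀ y : EuclideanSpace ℝ (Fin n), ‖y - x‖ ≤ β / α →
      f y - f x ≥ -(β ^ 2 / α + L / 24) * ‖y - x‖ ^ 4 := by
  intro y _
  have hfd : fderiv ℝ f x = 0 := by
    have : (InnerProductSpace.toDual ℝ _).symm (fderiv ℝ f x) = 0 := hgrad
    simpa using this
  obtain ⟨u, hu, v, hv, huv⟩ := U.exists_add_mem_mem_orthogonal (y - x)
  set h := y - x with hh
  have hy : y = x + (1 : ℝ) • h := by simp [hh]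
  have hnorm : ‖h‖ ^ 2 = ‖u‖ ^ 2 + ‖v‖ ^ 2 := by
    have := norm_add_sq_eq_norm_sq_add_norm_sq_of_inner_eq_zero u v (hv u hu)
    rw [huv]; nlinarith
  have hT := aux_taylor (fun t => iteratedFDeriv ℝ 0 f (x + t • h) ![])
    (fun t => iteratedFDeriv ℝ 1 f (x + t • h) ![h])
    (fun t => iteratedFDeriv ℝ 2 f (x + t • h) ![h, h])
    (fun t => iteratedFDeriv ℝ 3 f (x + t • h) ![h, h, h]) (L * ‖h‖ ^ 4)
    (fun t => aux_deriv hf 0 (by norm_num) x h ![] t)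
    (fun t => aux_deriv hf 1 (by norm_num) x h ![h] t)
    (fun t => aux_deriv hf 2 (by norm_num) x h ![h, h] t)
    (fun t ht => by
      have e1 := aux_frob (iteratedFDeriv ℝ 3 f (x + t • h) - iteratedFDeriv ℝ 3 f x) h
      have e2 := hLip (x + t • h) x
      have e3 : ‖x + t • h - x‖ = t * ‖h‖ := by
        rw [add_sub_cancel_left, norm_smul, Real.norm_of_nonneg ht]
      rw [e3] at e2
      have e4 := mul_le_mul_of_nonneg_right e2 (by positivity : 0 ≤ ‖h‖ ^ 3)
      have e5 := (abs_le.1 (e1.trans e4)).1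
      rw [ContinuousMultilinearMap.sub_apply] at e5
      simp only [zero_smul, add_zero]
      nlinarith)
  simp only [zero_smul, add_zero, ← hy, iteratedFDeriv_zero_apply, iteratedFDeriv_one_apply,
    hfd] at hT
  have add2 : ∀ a b c, iteratedFDeriv ℝ 2 f x ![a + b, c] =
      iteratedFDeriv ℝ 2 f x ![a, c] + iteratedFDeriv ℝ 2 f x ![b, c] := fun a b c =>
    ContinuousMultilinearMap.cons_add _ _ _ _
  have add3 : ∀ a b c d, iteratedFDeriv ℝ 3 f x ![a + b, c, d] =
      iteratedFDeriv ℝ 3 f x ![a, c, d] + iteratedFDeriv ℝ 3 f x ![b, c, d] := fun a b c d =>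
    ContinuousMultilinearMap.cons_add _ _ _ _
  have q2 : iteratedFDeriv ℝ 2 f x ![h, h] = iteratedFDeriv ℝ 2 f x ![v, v] := by
    rw [huv, add2, hkernel u hu, aux_sym2 hf, add2, hkernel u hu]
    simp
  have add3' : ∀ a b c d, iteratedFDeriv ℝ 3 f x ![c, a + b, d] =
      iteratedFDeriv ℝ 3 f x ![c, a, d] + iteratedFDeriv ℝ 3 f x ![c, b, d] := fun a b c d => by
    rw [aux_sym3b hf, add3, aux_sym3b hf x a, aux_sym3b hf x b]
  have add3'' : ∀ a b c d, iteratedFDeriv ℝ 3 f x ![c, d, a + b] =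
      iteratedFDeriv ℝ 3 f x ![c, d, a] + iteratedFDeriv ℝ 3 f x ![c, d, b] := fun a b c d => by
    rw [aux_sym3a hf, add3', aux_sym3a hf x c a, aux_sym3a hf x c b]
  have q3 : iteratedFDeriv ℝ 3 f x ![h, h, h] = 3 * iteratedFDeriv ℝ 3 f x ![u, u, v]
      + 3 * iteratedFDeriv ℝ 3 f x ![u, v, v] + iteratedFDeriv ℝ 3 f x ![v, v, v] := by
    have s1 : iteratedFDeriv ℝ 3 f x ![u, v, u] = iteratedFDeriv ℝ 3 f x ![u, u, v] :=
      aux_sym3a hf x _ _ _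
    have s2 : iteratedFDeriv ℝ 3 f x ![v, u, u] = iteratedFDeriv ℝ 3 f x ![u, u, v] :=
      (aux_sym3b hf x _ _ _).trans s1
    have s3 : iteratedFDeriv ℝ 3 f x ![v, u, v] = iteratedFDeriv ℝ 3 f x ![u, v, v] :=
      aux_sym3b hf x _ _ _
    have s4 : iteratedFDeriv ℝ 3 f x ![v, v, u] = iteratedFDeriv ℝ 3 f x ![u, v, v] :=
      (aux_sym3a hf x _ _ _).trans s3
    rw [huv]
    simp only [add3, add3', add3'', s1, s2, s3, s4, hU0 u hu]
    ring
  rw [q2, q3] at hT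
  have b1 := (abs_le.1 (hβ1 u hu v hv v hv)).1
  have b2 := (abs_le.1 (hβ2 u hu u hu v hv)).1
  have b3 := (abs_le.1 (hβ3 v hv v hv v hv)).1
  have b4 := hαeig v hv
  have fin := aux_real α β ‖u‖ ‖v‖ ‖h‖ hα hβ (norm_nonneg _) (norm_nonneg _) hnorm
  simp only [ContinuousLinearMap.zero_apply] at hT
  linarith
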